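/- A ternary cubic form f over ℂ has Waring rank 4 if and only if either f = a²·c + b³ for some linearly independent linear forms a, b, c, or f = a³ + b³ + c³ + d³ for some linear forms a, b, c, d that are triplewise linearly independent (every three of the four forms are linearly independent). -/

import Mathlib

open MvPolynomial

/-- Ternary forms: polynomials in three variables over `ℂ`. -/
abbrev Ternary : Type := MvPolynomial (Fin 3) ℂ

/-- A linear form is a homogeneous polynomial of degree 1. -/
def IsLinearForm (a : Ternary) : Prop := MvPolynomial.IsHomogeneous a 1

/-- The Waring rank of a form `f` (with respect to degree `d`): the least `r`
such that `f` is a sum of `r` `d`-th powers of linear forms. -/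
noncomputable def waringRank (d : ℕ) (f : Ternary) : ℕ :=
  sInf {r : ℕ | ∃ l : Fin r → Ternary, (∀ i, IsLinearForm (l i)) ∧ f = ∑ i, (l i) ^ d}

/-- The Hessian determinant of a ternary form: the determinant of the matrix of
second partial derivatives. -/
noncomputable def hess (f : Ternary) : Ternary :=
  Matrix.det (Matrix.of fun i j : Fin 3 =>
    MvPolynomial.pderiv i (MvPolynomial.pderiv j f))

/-- `[abc]`: the determinant of the 3×3 matrix whose rows are the coefficients of
the linear forms `a`, `b`, `c`. -/
noncomputable def bracket (a b c : Ternary) : ℂ :=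
  Matrix.det (Matrix.of
    ![![MvPolynomial.coeff (Finsupp.single 0 1) a, MvPolynomial.coeff (Finsupp.single 1 1) a,
        MvPolynomial.coeff (Finsupp.single 2 1) a],
      ![MvPolynomial.coeff (Finsupp.single 0 1) b, MvPolynomial.coeff (Finsupp.single 1 1) b,
        MvPolynomial.coeff (Finsupp.single 2 1) b],
      ![MvPolynomial.coeff (Finsupp.single 0 1) c, MvPolynomial.coeff (Finsupp.single 1 1) c,
        MvPolynomial.coeff (Finsupp.single 2 1) c]])

theorem isLinearForm_C_mul {a : Ternary} (k : ℂ) (ha : IsLinearForm a) :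
    IsLinearForm (C k * a) := by
  simpa [IsLinearForm] using (isHomogeneous_C (Fin 3) k).mul ha

theorem isLinearForm_combination {a b : Ternary} (ha : IsLinearForm a) (hb : IsLinearForm b)
    (s t : ℂ) : IsLinearForm (C s * a + C t * b) :=
  IsHomogeneous.add (isLinearForm_C_mul s ha) (isLinearForm_C_mul t hb)

theorem isLinearForm_zero : IsLinearForm 0 := isHomogeneous_zero _ _ _

theorem exists_cube_root (k : ℂ) : ∃ z : ℂ, z ^ 3 = k :=
  IsAlgClosed.exists_pow_nat_eq k (by norm_num)

/-- `f` is a sum of three cubes of linear forms. -/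
def IsSumThreeCubes (f : Ternary) : Prop :=
  ∃ u v w : Ternary, IsLinearForm u ∧ IsLinearForm v ∧ IsLinearForm w ∧ f = u ^ 3 + v ^ 3 + w ^ 3

/-- `f` is a cubic form in the forms `x` and `y`. -/
def IsBinaryCubic (x y f : Ternary) : Prop :=
  ∃ p q r s : ℂ, f = C p * x ^ 3 + C q * (x ^ 2 * y) + C r * (x * y ^ 2) + C s * y ^ 3

/-- `f = a ^ 2 * c + b ^ 3` with `a`, `b`, `c` linearly independent linear forms. -/
def IsTangentType (f : Ternary) : Prop :=
  ∃ a b c : Ternary, IsLinearForm a ∧ IsLinearForm b ∧ IsLinearForm c ∧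
    LinearIndependent ℂ ![a, b, c] ∧ f = a ^ 2 * c + b ^ 3

theorem exists_quadratic_factorization (p q r : ℂ) :
    ∃ a b c d : ℂ, ∀ x y : ℂ,
      p * x ^ 2 + q * (x * y) + r * y ^ 2 = (a * x + b * y) * (c * x + d * y) := by
  by_cases hp : p = 0
  · exact ⟨0, 1, q, r, fun x y => by subst hp; ring⟩
  · obtain ⟨z, hz⟩ := IsAlgClosed.exists_pow_nat_eq (q ^ 2 - 4 * p * r) (n := 2) (by norm_num)
    refine ⟨p, (q - z) / 2, 1, (q + z) / (2 * p), fun x y => ?_⟩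
    field_simp
    linear_combination (y ^ 2) * hz

theorem exists_cubic_factorization (p q r s : ℂ) :
    ∃ a b c d e g : ℂ, ∀ x y : ℂ,
      p * x ^ 3 + q * (x ^ 2 * y) + r * (x * y ^ 2) + s * y ^ 3 =
        (a * x + b * y) * ((c * x + d * y) * (e * x + g * y)) := by
  by_cases hp : p = 0
  · obtain ⟨c, d, e, g, h⟩ := exists_quadratic_factorization q r s
    exact ⟨0, 1, c, d, e, g, fun x y => by rw [← h]; subst hp; ring⟩
  · obtain ⟨z, hz⟩ := Complex.exists_root (f := (Cubic.mk p q r s).toPoly) (by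
      rw [Cubic.degree_of_a_ne_zero (by simpa using hp)]; norm_num)
    replace hz : p * z ^ 3 + q * z ^ 2 + r * z + s = 0 := by
      simpa [Cubic.toPoly, Polynomial.IsRoot] using hz
    obtain ⟨c, d, e, g, h⟩ := exists_quadratic_factorization p (q + p * z) (r + q * z + p * z ^ 2)
    refine ⟨1, -z, c, d, e, g, fun x y => ?_⟩
    rw [← h]
    linear_combination (y ^ 3) * hz

theorem exists_cubes_of_mul_mul_add (u v : Ternary) (hu : IsLinearForm u) (hv : IsLinearForm v)
    (s t : ℂ) (hs : s ≠ 0) (ht : t ≠ 0) :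
    ∃ l m : Ternary, IsLinearForm l ∧ IsLinearForm m ∧
      u * v * (C s * u + C t * v) = l ^ 3 + m ^ 3 := by
  obtain ⟨i, hi⟩ := IsAlgClosed.exists_pow_nat_eq (-3 : ℂ) (n := 2) (by norm_num)
  have hi0 : i ≠ 0 := by rintro rfl; norm_num at hi
  obtain ⟨z, hz⟩ := exists_cube_root (-1 / (3 * i * s * t))
  refine ⟨C (z * s) * u + C (- z * ((-1 + i) / 2) * t) * v,
    C (- z * s) * u + C (z * ((-1 - i) / 2) * t) * v,
    isLinearForm_combination hu hv _ _, isLinearForm_combination hu hv _ _, ?_⟩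
  have hk : 1 = - z ^ 3 * (3 * i * s * t) := by rw [hz]; field_simp
  apply MvPolynomial.funext
  intro x
  simp only [map_mul, map_add, map_pow, eval_C]
  set U := eval x u
  set V := eval x v
  linear_combination (z ^ 3 * t ^ 3 * V ^ 3 * i / 4) * hi + (U * V * (s * U + t * V)) * hk

/-- A binary cubic is a sum of two cubes or has a squared linear factor. -/
theorem IsBinaryCubic.two_cubes_or_sq_mul {x y f : Ternary} (hx : IsLinearForm x)
    (hy : IsLinearForm y) (hf : IsBinaryCubic x y f) :
    ∃ u v : Ternary, IsLinearForm u ∧ IsLinearForm v ∧ (f = u ^ 3 + v ^ 3 ∨ f = u ^ 2 * v) := by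
  obtain ⟨p, q, r, s, rfl⟩ := hf
  obtain ⟨a, b, c, d, e, g, h⟩ := exists_cubic_factorization p q r s
  set u := C a * x + C b * y with hu
  set v := C c * x + C d * y with hv
  set w := C e * x + C g * y with hw
  have lu : IsLinearForm u := isLinearForm_combination hx hy _ _
  have lv : IsLinearForm v := isLinearForm_combination hx hy _ _
  have lw : IsLinearForm w := isLinearForm_combination hx hy _ _
  have key : C p * x ^ 3 + C q * (x ^ 2 * y) + C r * (x * y ^ 2) + C s * y ^ 3 = u * v * w := by
    apply MvPolynomial.funext
    intro t
    simp only [hu, hv, hw, map_mul, map_add, map_pow, eval_C, h]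
    ring
  rw [key]
  by_cases hδ : a * d - b * c = 0
  · have hdep : (∃ k, v = C k * u) ∨ ∃ k, u = C k * v := by
      by_cases ha : a = 0
      · by_cases hb : b = 0
        · exact Or.inr ⟨0, by simp [hu, ha, hb]⟩
        · refine Or.inl ⟨d / b, ?_⟩
          have hc : c = 0 := by simpa [ha, hb] using hδ
          apply MvPolynomial.funext
          intro t
          simp only [hu, hv, map_mul, map_add, eval_C, ha, hc]
          field_simp
          ring
      · refine Or.inl ⟨c / a, ?_⟩
        apply MvPolynomial.funext
        intro t
        simp only [hu, hv, map_mul, map_add, eval_C]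
        field_simp
        linear_combination (eval t y) * hδ
    rcases hdep with ⟨k, hk⟩ | ⟨k, hk⟩
    · exact ⟨u, C k * w, lu, isLinearForm_C_mul _ lw, Or.inr (by rw [hk]; ring)⟩
    · exact ⟨v, C k * w, lv, isLinearForm_C_mul _ lw, Or.inr (by rw [hk]; ring)⟩
  · obtain ⟨m, n, hmn⟩ : ∃ m n, w = C m * u + C n * v := by
      have hinv := inv_mul_cancel₀ hδ
      refine ⟨(a * d - b * c)⁻¹ * (e * d - g * c), (a * d - b * c)⁻¹ * (a * g - b * e), ?_⟩
      apply MvPolynomial.funext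
      intro t
      simp only [hu, hv, hw, map_mul, map_add, eval_C]
      generalize (a * d - b * c)⁻¹ = δ at *
      linear_combination -(e * eval t x + g * eval t y) * hinv
    by_cases hm : m = 0
    · exact ⟨v, C n * u, lv, isLinearForm_C_mul _ lu, Or.inr (by rw [hmn, hm]; simp; ring)⟩
    by_cases hn : n = 0
    · exact ⟨u, C m * v, lu, isLinearForm_C_mul _ lv, Or.inr (by rw [hmn, hn]; simp; ring)⟩
    obtain ⟨l, l', hl, hl', hll⟩ := exists_cubes_of_mul_mul_add u v lu lv m n hm hn
    exact ⟨l, l', hl, hl', Or.inl (by rw [hmn, hll])⟩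

theorem exists_three_cubes_of_sq_mul {u v : Ternary} (hu : IsLinearForm u) (hv : IsLinearForm v) :
    IsSumThreeCubes (u ^ 2 * v) := by
  obtain ⟨z, hz⟩ := exists_cube_root (1 / 6)
  obtain ⟨w, hw⟩ := exists_cube_root (-1 / 3)
  refine ⟨C z * u + C z * v, C (-z) * u + C z * v, C w * v, isLinearForm_combination hu hv _ _,
    isLinearForm_combination hu hv _ _, isLinearForm_C_mul _ hv, ?_⟩
  apply MvPolynomial.funext
  intro t
  simp only [map_mul, map_add, map_pow, eval_C]
  set U := eval t u
  set V := eval t v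
  linear_combination (-(U + V) ^ 3 - (V - U) ^ 3) * hz - V ^ 3 * hw

theorem IsBinaryCubic.isSumThreeCubes {x y f : Ternary} (hx : IsLinearForm x)
    (hy : IsLinearForm y) (hf : IsBinaryCubic x y f) : IsSumThreeCubes f := by
  obtain ⟨u, v, hu, hv, rfl | rfl⟩ := hf.two_cubes_or_sq_mul hx hy
  · exact ⟨u, v, 0, hu, hv, isLinearForm_zero, by simp⟩
  · exact exists_three_cubes_of_sq_mul hu hv

/-- A linear dependency among three forms expresses one of them through the other two. -/
theorem exists_combination_of_not_linearIndependent {a b c : Ternary}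
    (h : ¬ LinearIndependent ℂ ![a, b, c]) :
    (∃ s t, c = C s * a + C t * b) ∨ (∃ s t, b = C s * a + C t * c) ∨
      ∃ s t, a = C s * b + C t * c := by
  obtain ⟨g, hg, i, hi⟩ := Fintype.not_linearIndependent_iff.mp h
  simp only [Fin.sum_univ_three, Matrix.cons_val_zero, Matrix.cons_val_one, Matrix.cons_val,
    smul_eq_C_mul] at hg
  have hg' : ∀ t, g 0 * eval t a + g 1 * eval t b + g 2 * eval t c = 0 := fun t => by
    simpa using congrArg (eval t) hg
  fin_cases i
  · refine Or.inr (Or.inr ⟨- g 1 / g 0, - g 2 / g 0, MvPolynomial.funext fun t => ?_⟩)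
    have : g 0 ≠ 0 := hi
    simp only [map_mul, map_add, eval_C]
    field_simp
    linear_combination hg' t
  · refine Or.inr (Or.inl ⟨- g 0 / g 1, - g 2 / g 1, MvPolynomial.funext fun t => ?_⟩)
    have : g 1 ≠ 0 := hi
    simp only [map_mul, map_add, eval_C]
    field_simp
    linear_combination hg' t
  · refine Or.inl ⟨- g 0 / g 2, - g 1 / g 2, MvPolynomial.funext fun t => ?_⟩
    have : g 2 ≠ 0 := hi
    simp only [map_mul, map_add, eval_C]
    field_simp
    linear_combination hg' t

theorem isBinaryCubic_sq_mul_add_cube (u v : Ternary) (s t : ℂ) :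
    IsBinaryCubic u v (u ^ 2 * v + (C s * u + C t * v) ^ 3) :=
  ⟨s ^ 3, 1 + 3 * s ^ 2 * t, 3 * s * t ^ 2, t ^ 3, MvPolynomial.funext fun x => by
    simp only [map_mul, map_add, map_pow, eval_C]; ring⟩

theorem isBinaryCubic_sum_cubes (u v : Ternary) (s t : ℂ) :
    IsBinaryCubic u v (u ^ 3 + v ^ 3 + (C s * u + C t * v) ^ 3) :=
  ⟨1 + s ^ 3, 3 * s ^ 2 * t, 3 * s * t ^ 2, 1 + t ^ 3, MvPolynomial.funext fun x => by
    simp only [map_mul, map_add, map_pow, eval_C]; ring⟩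

theorem isSumThreeCubes_or_isTangentType_of_sq_mul {u v d : Ternary} (hu : IsLinearForm u)
    (hv : IsLinearForm v) (hd : IsLinearForm d) :
    IsSumThreeCubes (u ^ 2 * v + d ^ 3) ∨ IsTangentType (u ^ 2 * v + d ^ 3) := by
  by_cases h : LinearIndependent ℂ ![u, d, v]
  · exact Or.inr ⟨u, d, v, hu, hd, hv, h, rfl⟩
  left
  rcases exists_combination_of_not_linearIndependent h with ⟨s, t, rfl⟩ | ⟨s, t, rfl⟩ | ⟨s, t, rfl⟩
  · refine IsBinaryCubic.isSumThreeCubes hu hd ⟨s, t, 0, 1, ?_⟩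
    simp
    ring
  · exact (isBinaryCubic_sq_mul_add_cube u v s t).isSumThreeCubes hu hv
  · refine IsBinaryCubic.isSumThreeCubes hd hv
      ⟨1, s ^ 2, 2 * s * t, t ^ 2, MvPolynomial.funext fun x => ?_⟩
    simp only [map_mul, map_add, map_pow, eval_C]
    ring

theorem isSumThreeCubes_or_isTangentType_of_combination {a b d : Ternary} (ha : IsLinearForm a)
    (hb : IsLinearForm b) (hd : IsLinearForm d) (s t : ℂ) {f : Ternary}
    (hf : f = a ^ 3 + b ^ 3 + (C s * a + C t * b) ^ 3 + d ^ 3) :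
    IsSumThreeCubes f ∨ IsTangentType f := by
  subst hf
  obtain ⟨u, v, hu, hv, h | h⟩ := (isBinaryCubic_sum_cubes a b s t).two_cubes_or_sq_mul ha hb
  · exact Or.inl ⟨u, v, d, hu, hv, hd, by rw [h]⟩
  · rw [h]
    exact isSumThreeCubes_or_isTangentType_of_sq_mul hu hv hd

theorem isSumThreeCubes_or_isTangentType_of_not_linearIndependent {a b c d : Ternary}
    (ha : IsLinearForm a) (hb : IsLinearForm b) (hc : IsLinearForm c) (hd : IsLinearForm d)
    (h : ¬ LinearIndependent ℂ ![a, b, c]) {f : Ternary}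
    (hf : f = a ^ 3 + b ^ 3 + c ^ 3 + d ^ 3) :
    IsSumThreeCubes f ∨ IsTangentType f := by
  rcases exists_combination_of_not_linearIndependent h with ⟨s, t, rfl⟩ | ⟨s, t, rfl⟩ | ⟨s, t, rfl⟩
  · exact isSumThreeCubes_or_isTangentType_of_combination ha hb hd s t hf
  · exact isSumThreeCubes_or_isTangentType_of_combination ha hc hd s t (by rw [hf]; ring)
  · exact isSumThreeCubes_or_isTangentType_of_combination hb hc hd s t (by rw [hf]; ring)

/-- The coefficient vector of a linear form. -/
theorem IsLinearForm.exists_coeff {l : Ternary} (hl : IsLinearForm l) :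
    ∃ k : Fin 3 → ℂ, l = ∑ i, k i • X i := by
  have : l ∈ homogeneousSubmodule (Fin 3) ℂ 1 := hl
  rw [homogeneousSubmodule_one_eq_span_X, Submodule.mem_span_range_iff_exists_fun] at this
  obtain ⟨k, hk⟩ := this
  exact ⟨k, hk.symm⟩

/-- Linearly independent linear forms serve as coordinates on `ℂ³`. -/
theorem exists_coordinates {a : Fin 3 → Ternary} (ha : ∀ i, IsLinearForm (a i))
    (h : LinearIndependent ℂ a) :
    ∃ E : Matrix (Fin 3) (Fin 3) ℂ, (∀ x i, eval (E.mulVec x) (a i) = x i) ∧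
      ∀ v, E.mulVec (fun i => eval v (a i)) = v := by
  choose M hM using fun i => (ha i).exists_coeff
  have hMrow : LinearIndependent ℂ M := by
    refine LinearIndependent.of_comp (Fintype.linearCombination ℂ (X : Fin 3 → Ternary)) ?_
    convert h using 1
    ext1 i
    simp [Fintype.linearCombination_apply, hM i]
  have hunit : IsUnit (Matrix.of M) := Matrix.linearIndependent_rows_iff_isUnit.mp hMrow
  have hdet := (Matrix.isUnit_iff_isUnit_det _).mp hunit
  have heval : ∀ v i, eval v (a i) = (Matrix.of M).mulVec v i := fun v i => by
    rw [hM i]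
    simp [Matrix.mulVec, dotProduct, smul_eval]
  refine ⟨(Matrix.of M)⁻¹, fun x i => ?_, fun v => ?_⟩
  · rw [heval, Matrix.mulVec_mulVec, Matrix.mul_nonsing_inv _ hdet, Matrix.one_mulVec]
  · simp only [heval]
    change (Matrix.of M)⁻¹.mulVec ((Matrix.of M).mulVec v) = v
    rw [Matrix.mulVec_mulVec, Matrix.nonsing_inv_mul _ hdet, Matrix.one_mulVec]

theorem IsLinearForm.exists_eval_mulVec {l : Ternary} (hl : IsLinearForm l)
    (E : Matrix (Fin 3) (Fin 3) ℂ) :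
    ∃ k : Fin 3 → ℂ, ∀ x, eval (E.mulVec x) l = k ⬝ᵥ x := by
  obtain ⟨k, rfl⟩ := hl.exists_coeff
  refine ⟨Matrix.vecMul k E, fun x => ?_⟩
  rw [← Matrix.dotProduct_mulVec]
  simp [dotProduct, smul_eval]

/-- Let `T` be a sum of cubes of three linear functionals on `ℂ³`, as a trilinear form. Then some
nonzero vector contracts `T` to `0`, or a basis of `ℂ³` contracts `T` to squares. -/
theorem exists_contraction (K : Matrix (Fin 3) (Fin 3) ℂ)
    (T : (Fin 3 → ℂ) → (Fin 3 → ℂ) → (Fin 3 → ℂ) → ℂ)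
    (hT : ∀ u v w, T u v w = ∑ i, K.mulVec u i * K.mulVec v i * K.mulVec w i) :
    (∃ D, D ≠ 0 ∧ ∀ v w, T D v w = 0) ∨
      ∃ N : Matrix (Fin 3) (Fin 3) ℂ, N.det ≠ 0 ∧
        ∀ i, ∃ m : (Fin 3 → ℂ) → ℂ, ∀ v w, T (fun j => N j i) v w = m v * m w := by
  by_cases hK : K.det = 0
  · obtain ⟨D, hD, h0⟩ := Matrix.exists_mulVec_eq_zero_iff.mpr hK
    exact Or.inl ⟨D, hD, fun v w => by simp [hT, h0]⟩
  · right
    have hu : IsUnit K.det := isUnit_iff_ne_zero.mpr hK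
    refine ⟨K⁻¹, ?_, fun i => ⟨fun v => K.mulVec v i, fun v w => ?_⟩⟩
    · exact (Matrix.isUnit_nonsing_inv_det K hu).ne_zero
    · have hcol : ∀ j, K.mulVec (fun j => K⁻¹ j i) j = (1 : Matrix (Fin 3) (Fin 3) ℂ) j i := by
        intro j
        rw [← Matrix.mul_nonsing_inv K hu]
        rfl
      simp [hT, hcol, Matrix.one_apply]

theorem IsSumThreeCubes.exists_eval_mulVec {f : Ternary} (hf : IsSumThreeCubes f)
    (E : Matrix (Fin 3) (Fin 3) ℂ) :
    ∃ K : Matrix (Fin 3) (Fin 3) ℂ,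
      ∀ x, eval (E.mulVec x) f = ∑ i, K.mulVec x i ^ 3 := by
  obtain ⟨u, v, w, hu, hv, hw, rfl⟩ := hf
  obtain ⟨k, hk⟩ := hu.exists_eval_mulVec E
  obtain ⟨l, hl⟩ := hv.exists_eval_mulVec E
  obtain ⟨m, hm⟩ := hw.exists_eval_mulVec E
  exact ⟨Matrix.of ![k, l, m], fun x => by simp [Fin.sum_univ_three, hk, hl, hm, Matrix.mulVec]⟩

theorem exists_contraction_of_cubic (K : Matrix (Fin 3) (Fin 3) ℂ) (F : (Fin 3 → ℂ) → ℂ)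
    (T : (Fin 3 → ℂ) → (Fin 3 → ℂ) → (Fin 3 → ℂ) → ℂ)
    (hF : ∀ x, F x = ∑ i, K.mulVec x i ^ 3)
    (hT : ∀ u v w, 6 * T u v w = F (u + v + w) - F (u + v) - F (u + w) - F (v + w)
      + F u + F v + F w) :
    (∃ D, D ≠ 0 ∧ ∀ v w, T D v w = 0) ∨
      ∃ N : Matrix (Fin 3) (Fin 3) ℂ, N.det ≠ 0 ∧
        ∀ i, ∃ m : (Fin 3 → ℂ) → ℂ, ∀ v w, T (fun j => N j i) v w = m v * m w := by
  refine exists_contraction K T fun u v w => ?_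
  have h := hT u v w
  simp only [hF, Matrix.mulVec_add, Pi.add_apply, Fin.sum_univ_three] at h
  rw [Fin.sum_univ_three]
  linear_combination h / 6

theorem IsTangentType.not_isSumThreeCubes {f : Ternary} (hf : IsTangentType f) :
    ¬ IsSumThreeCubes f := by
  intro hs
  obtain ⟨a, b, c, ha, hb, hc, h, rfl⟩ := hf
  obtain ⟨E, hE, -⟩ := exists_coordinates (a := ![a, b, c])
    (by intro i; fin_cases i <;> assumption) h
  obtain ⟨K, hK⟩ := hs.exists_eval_mulVec E
  have ea : ∀ x, eval (E.mulVec x) a = x 0 := fun x => hE x 0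
  have eb : ∀ x, eval (E.mulVec x) b = x 1 := fun x => hE x 1
  have ec : ∀ x, eval (E.mulVec x) c = x 2 := fun x => hE x 2
  simp only [map_mul, map_add, map_pow, ea, eb, ec] at hK
  rcases exists_contraction_of_cubic K _
    (fun u v w => (u 0 * v 0 * w 2 + u 0 * v 2 * w 0 + u 2 * v 0 * w 0) / 3 + u 1 * v 1 * w 1)
    hK (fun u v w => by simp only [Pi.add_apply]; ring) with ⟨D, hD, h0⟩ | ⟨N, hN, h1⟩
  · apply hD
    have h02 := h0 ![1, 0, 0] ![0, 0, 1]
    have h00 := h0 ![1, 0, 0] ![1, 0, 0]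
    have h11 := h0 ![0, 1, 0] ![0, 1, 0]
    simp at h02 h00 h11
    ext i
    fin_cases i <;> assumption
  · apply hN
    apply Matrix.det_eq_zero_of_row_eq_zero 0
    intro i
    obtain ⟨m, hm⟩ := h1 i
    have h02 := hm ![1, 0, 0] ![0, 0, 1]
    have h22 := hm ![0, 0, 1] ![0, 0, 1]
    simp at h02 h22
    simpa [h22] using h02

theorem not_isSumThreeCubes_of_general_position {a b c d : Ternary} (ha : IsLinearForm a)
    (hb : IsLinearForm b) (hc : IsLinearForm c) (hd : IsLinearForm d)
    (habc : LinearIndependent ℂ ![a, b, c]) (habd : LinearIndependent ℂ ![a, b, d])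
    (hacd : LinearIndependent ℂ ![a, c, d]) (hbcd : LinearIndependent ℂ ![b, c, d]) :
    ¬ IsSumThreeCubes (a ^ 3 + b ^ 3 + c ^ 3 + d ^ 3) := by
  intro hs
  obtain ⟨E, hE, hE'⟩ := exists_coordinates (a := ![a, b, c])
    (by intro i; fin_cases i <;> assumption) habc
  obtain ⟨K, hK⟩ := hs.exists_eval_mulVec E
  obtain ⟨k, hk⟩ := hd.exists_eval_mulVec E
  have hdk : ∀ v, eval v d = k 0 * eval v a + k 1 * eval v b + k 2 * eval v c := fun v => by
    have := hk (fun i => eval v (![a, b, c] i))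
    rw [hE'] at this
    simpa [dotProduct, Fin.sum_univ_three] using this
  have hpoint : ∀ {p q : Ternary}, IsLinearForm p → IsLinearForm q →
      LinearIndependent ℂ ![p, q, d] → ∃ v, eval v p = 0 ∧ eval v q = 0 ∧ eval v d = 1 := by
    intro p q hp hq h
    obtain ⟨G, hG, -⟩ := exists_coordinates (a := ![p, q, d])
      (by intro i; fin_cases i <;> assumption) h
    exact ⟨_, hG ![0, 0, 1] 0, hG ![0, 0, 1] 1, hG ![0, 0, 1] 2⟩
  have k0 : k 0 ≠ 0 := by
    obtain ⟨v, h1, h2, h3⟩ := hpoint hb hc hbcd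
    intro h0
    simpa [h0, h1, h2, h3] using hdk v
  have k1 : k 1 ≠ 0 := by
    obtain ⟨v, h1, h2, h3⟩ := hpoint ha hc hacd
    intro h0
    simpa [h0, h1, h2, h3] using hdk v
  have k2 : k 2 ≠ 0 := by
    obtain ⟨v, h1, h2, h3⟩ := hpoint ha hb habd
    intro h0
    simpa [h0, h1, h2, h3] using hdk v
  have ea : ∀ x, eval (E.mulVec x) a = x 0 := fun x => hE x 0
  have eb : ∀ x, eval (E.mulVec x) b = x 1 := fun x => hE x 1
  have ec : ∀ x, eval (E.mulVec x) c = x 2 := fun x => hE x 2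
  simp only [map_add, map_pow, ea, eb, ec, hk] at hK
  have hzero : ∀ (D : Fin 3 → ℂ) (m : (Fin 3 → ℂ) → ℂ), (∀ v w, D 0 * v 0 * w 0 + D 1 * v 1 * w 1
      + D 2 * v 2 * w 2 + (k ⬝ᵥ D) * (k ⬝ᵥ v) * (k ⬝ᵥ w) = m v * m w) → D = 0 := by
    intro D m hm
    have h00 := hm ![1, 0, 0] ![1, 0, 0]
    have h01 := hm ![1, 0, 0] ![0, 1, 0]
    have h02 := hm ![1, 0, 0] ![0, 0, 1]
    have h11 := hm ![0, 1, 0] ![0, 1, 0]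
    have h12 := hm ![0, 1, 0] ![0, 0, 1]
    have h22 := hm ![0, 0, 1] ![0, 0, 1]
    generalize m ![1, 0, 0] = m0 at *
    generalize m ![0, 1, 0] = m1 at *
    generalize m ![0, 0, 1] = m2 at *
    obtain ⟨s, hs⟩ : ∃ s, s = k ⬝ᵥ D := ⟨_, rfl⟩
    rw [← hs] at h00 h01 h02 h11 h12 h22
    simp [dotProduct, Fin.sum_univ_three] at h00 h01 h02 h11 h12 h22 hs
    have p0 : s * D 0 = 0 := by
      have : s * D 0 * (k 1 * k 2) = 0 := by
        linear_combination s * k 1 * k 2 * h00 + m0 * m0 * h12 - s * k 0 * k 1 * h02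
          - m0 * m2 * h01
      simpa [k1, k2] using this
    have p1 : s * D 1 = 0 := by
      have : s * D 1 * (k 0 * k 2) = 0 := by
        linear_combination s * k 0 * k 2 * h11 + m1 * m1 * h02 - s * k 0 * k 1 * h12
          - m1 * m2 * h01
      simpa [k0, k2] using this
    have p2 : s * D 2 = 0 := by
      have : s * D 2 * (k 0 * k 1) = 0 := by
        linear_combination s * k 0 * k 1 * h22 + m2 * m2 * h01 - s * k 0 * k 2 * h12
          - m1 * m2 * h02
      simpa [k0, k1] using this
    have s0 : s = 0 := by
      have : s ^ 2 = 0 := by linear_combination s * hs + k 0 * p0 + k 1 * p1 + k 2 * p2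
      simpa using this
    subst s0
    simp at h00 h01 h02 h11 h12 h22
    have q01 : D 0 * D 1 = 0 := by rw [h00, h11]; grind
    have q02 : D 0 * D 2 = 0 := by rw [h00, h22]; grind
    have q12 : D 1 * D 2 = 0 := by rw [h11, h22]; grind
    ext i
    fin_cases i <;> simp <;> grind
  rcases exists_contraction_of_cubic K _
    (fun u v w => u 0 * v 0 * w 0 + u 1 * v 1 * w 1 + u 2 * v 2 * w 2
      + (k ⬝ᵥ u) * (k ⬝ᵥ v) * (k ⬝ᵥ w))
    hK (fun u v w => by simp only [Pi.add_apply, dotProduct_add]; ring)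
    with ⟨D, hD, h0⟩ | ⟨N, hN, h1⟩
  · exact hD (hzero D (fun _ => 0) fun v w => by simpa using h0 v w)
  · obtain ⟨m, hm⟩ := h1 0
    have hcol := hzero (fun j => N j 0) m hm
    exact hN (Matrix.det_eq_zero_of_column_eq_zero 0 fun i => congrFun hcol i)

theorem waringRank_eq_four_iff (f : Ternary) :
    waringRank 3 f = 4 ↔ ¬ IsSumThreeCubes f ∧ ∃ a b c d : Ternary, IsLinearForm a ∧
      IsLinearForm b ∧ IsLinearForm c ∧ IsLinearForm d ∧ f = a ^ 3 + b ^ 3 + c ^ 3 + d ^ 3 := by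
  constructor
  · intro h
    refine ⟨fun ⟨u, v, w, hu, hv, hw, e⟩ => ?_, ?_⟩
    · refine Nat.notMem_of_lt_sInf (m := 3) (h.symm ▸ (by norm_num : 3 < 4) : 3 < waringRank 3 f)
        ⟨![u, v, w], ?_, ?_⟩
      · intro i; fin_cases i <;> assumption
      · simpa [Fin.sum_univ_three] using e
    · have hmem := Nat.sInf_mem (Nat.nonempty_of_pos_sInf
        (h.symm ▸ (by norm_num : 0 < 4) : 0 < waringRank 3 f))
      change waringRank 3 f ∈ _ at hmem
      rw [h] at hmem
      obtain ⟨l, hl, e⟩ := hmem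
      exact ⟨l 0, l 1, l 2, l 3, hl 0, hl 1, hl 2, hl 3, by rw [e, Fin.sum_univ_four]⟩
  · rintro ⟨hn, a, b, c, d, ha, hb, hc, hd, e⟩
    have hmem : 4 ∈ {r : ℕ | ∃ l : Fin r → Ternary, (∀ i, IsLinearForm (l i)) ∧
        f = ∑ i, (l i) ^ 3} := by
      refine ⟨![a, b, c, d], ?_, ?_⟩
      · intro i; fin_cases i <;> assumption
      · simpa [Fin.sum_univ_four] using e
    refine le_antisymm (Nat.sInf_le hmem) (le_csInf ⟨4, hmem⟩ ?_)
    rintro r ⟨l, hl, e⟩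
    by_contra! hr
    apply hn
    interval_cases r
    · exact ⟨0, 0, 0, isLinearForm_zero, isLinearForm_zero, isLinearForm_zero, by simpa using e⟩
    · exact ⟨l 0, 0, 0, hl 0, isLinearForm_zero, isLinearForm_zero, by simpa using e⟩
    · exact ⟨l 0, l 1, 0, hl 0, hl 1, isLinearForm_zero, by simpa using e⟩
    · exact ⟨l 0, l 1, l 2, hl 0, hl 1, hl 2, by rw [e, Fin.sum_univ_three]⟩

/-- Characterization of ternary cubic forms of Waring rank 4. -/
theorem cubic_rank_four_iff (f : Ternary) (hf : MvPolynomial.IsHomogeneous f 3) :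
    waringRank 3 f = 4 ↔
      ((∃ a b c : Ternary, IsLinearForm a ∧ IsLinearForm b ∧ IsLinearForm c ∧
          LinearIndependent ℂ ![a, b, c] ∧ f = a ^ 2 * c + b ^ 3) ∨
       (∃ a b c d : Ternary, IsLinearForm a ∧ IsLinearForm b ∧ IsLinearForm c ∧
          IsLinearForm d ∧
          LinearIndependent ℂ ![a, b, c] ∧ LinearIndependent ℂ ![a, b, d] ∧
          LinearIndependent ℂ ![a, c, d] ∧ LinearIndependent ℂ ![b, c, d] ∧
          f = a ^ 3 + b ^ 3 + c ^ 3 + d ^ 3)) := by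
  rw [waringRank_eq_four_iff]
  constructor
  · rintro ⟨hn, a, b, c, d, ha, hb, hc, hd, e⟩
    by_cases habc : LinearIndependent ℂ ![a, b, c]
    swap
    · exact Or.inl ((isSumThreeCubes_or_isTangentType_of_not_linearIndependent ha hb hc hd habc
        e).resolve_left hn)
    by_cases habd : LinearIndependent ℂ ![a, b, d]
    swap
    · exact Or.inl ((isSumThreeCubes_or_isTangentType_of_not_linearIndependent ha hb hd hc habd
        (by rw [e]; ring)).resolve_left hn)
    by_cases hacd : LinearIndependent ℂ ![a, c, d]
    swap
    · exact Or.inl ((isSumThreeCubes_or_isTangentType_of_not_linearIndependent ha hc hd hb hacd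
        (by rw [e]; ring)).resolve_left hn)
    by_cases hbcd : LinearIndependent ℂ ![b, c, d]
    swap
    · exact Or.inl ((isSumThreeCubes_or_isTangentType_of_not_linearIndependent hb hc hd ha hbcd
        (by rw [e]; ring)).resolve_left hn)
    exact Or.inr ⟨a, b, c, d, ha, hb, hc, hd, habc, habd, hacd, hbcd, e⟩
  · rintro (h | ⟨a, b, c, d, ha, hb, hc, hd, habc, habd, hacd, hbcd, rfl⟩)
    · refine ⟨IsTangentType.not_isSumThreeCubes h, ?_⟩
      obtain ⟨a, b, c, ha, hb, hc, -, rfl⟩ := h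
      obtain ⟨u, v, w, hu, hv, hw, e⟩ := exists_three_cubes_of_sq_mul ha hc
      exact ⟨u, v, w, b, hu, hv, hw, hb, by rw [e]⟩
    · exact ⟨not_isSumThreeCubes_of_general_position ha hb hc hd habc habd hacd hbcd,
        a, b, c, d, ha, hb, hc, hd, rfl⟩
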